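/- arXiv:2501.04110 — 3 statements merged into one kernel-verified Lean document; each statement's English description precedes it below -/
import Mathlib

section
/- Let q ≥ 1 be an integer and H a finite subgroup of GL(q, ℂ). Then there exist ℂ-linear functionals L₁, …, L_q : ℂ^q → ℂ such that for every choice of elements g₁, …, g_q ∈ H, the intersection of kernels ⋂_{j=1}^{q} ker(L_j ∘ g_j) equals {0}. -/
theorem stmt_1_aux (q : ℕ)
    (H : Subgroup (LinearMap.GeneralLinearGroup ℂ (Fin q → ℂ))) [Fintype H] (k : ℕ) (hk : k ≤ q) :
    ∃ L : Fin k → ((Fin q → ℂ) →ₗ[ℂ] ℂ),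
      ∀ g : Fin k → H,
        Module.finrank ℂ (⨅ j : Fin k, LinearMap.ker ((L j).comp
          (((g j : LinearMap.GeneralLinearGroup ℂ (Fin q → ℂ)) :
            (Fin q → ℂ) →ₗ[ℂ] (Fin q → ℂ)))) : Submodule ℂ (Fin q → ℂ)) + k ≤ q := by
  induction k with
  | zero =>
    refine ⟨fun _ => 0, fun g => ?_⟩
    simpa using Submodule.finrank_le (⨅ j : Fin 0, LinearMap.ker ((0 : (Fin q → ℂ) →ₗ[ℂ] ℂ).comp
          (((g j : LinearMap.GeneralLinearGroup ℂ (Fin q → ℂ)) :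
            (Fin q → ℂ) →ₗ[ℂ] (Fin q → ℂ)))))
  | succ k ih =>
    obtain ⟨L, hL⟩ := ih (by omega)
    set W : (Fin k → H) → Submodule ℂ (Fin q → ℂ) := fun g => ⨅ j : Fin k, LinearMap.ker ((L j).comp
          (((g j : LinearMap.GeneralLinearGroup ℂ (Fin q → ℂ)) :
            (Fin q → ℂ) →ₗ[ℂ] (Fin q → ℂ)))) with hW
    have hw : ∀ g : {g : Fin k → H // W g ≠ ⊥}, ∃ w ∈ W g.1, w ≠ 0 :=
      fun g => Submodule.exists_mem_ne_zero_of_ne_bot g.2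
    choose w hwm hw0 using hw
    obtain ⟨l, hl⟩ := Submodule.exists_forall_notMem_of_forall_ne_top
      (K := ℂ) (M := Module.Dual ℂ (Fin q → ℂ))
      (fun i : {g : Fin k → H // W g ≠ ⊥} × H =>
        LinearMap.ker (Module.Dual.eval ℂ (Fin q → ℂ)
          ((i.2 : LinearMap.GeneralLinearGroup ℂ (Fin q → ℂ)).toLinearEquiv (w i.1))))
      (by
        rintro ⟨g, h⟩ htop
        rw [LinearMap.ker_eq_top] at htop
        apply hw0 g
        have := (Module.forall_dual_apply_eq_zero_iff ℂ _).1 (fun f => LinearMap.congr_fun htop f)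
        exact (LinearEquiv.map_eq_zero_iff _).1 this)
    refine ⟨Fin.snoc L l, fun g => ?_⟩
    set V := (⨅ j : Fin (k+1), LinearMap.ker (((Fin.snoc L l : Fin (k+1) → ((Fin q → ℂ) →ₗ[ℂ] ℂ)) j).comp
          (((g j : LinearMap.GeneralLinearGroup ℂ (Fin q → ℂ)) :
            (Fin q → ℂ) →ₗ[ℂ] (Fin q → ℂ)))) : Submodule ℂ (Fin q → ℂ)) with hV
    have hle : V ≤ W (fun j => g j.castSucc) := by
      refine le_iInf fun j => ?_
      refine (iInf_le _ j.castSucc).trans ?_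
      simp
    by_cases hb : W (fun j => g j.castSucc) = ⊥
    · rw [hb, le_bot_iff] at hle
      rw [hle]; simpa using hk
    · have hlt : V < W (fun j => g j.castSucc) := by
        refine lt_of_le_of_ne hle fun he => ?_
        apply hl (⟨_, hb⟩, g (Fin.last k))
        have h1 := hwm ⟨_, hb⟩
        simp only at h1
        rw [← he] at h1
        have h2 := (Submodule.mem_iInf _).1 h1 (Fin.last k)
        simpa using h2
      have := Submodule.finrank_lt_finrank_of_lt hlt
      have : Module.finrank ℂ (W (fun j => g j.castSucc)) + k ≤ q := hL (fun j => g j.castSucc)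
      omega

/-- For a finite subgroup `H` of `GL(q, ℂ)` there exist linear functionals
`L₁, …, L_q` such that for every choice `g₁, …, g_q ∈ H` the intersection of the kernels
of the `L_j ∘ g_j` is `{0}`. -/
theorem stmt_1 (q : ℕ) (hq : 1 ≤ q)
    (H : Subgroup (LinearMap.GeneralLinearGroup ℂ (Fin q → ℂ))) [Fintype H] :
    ∃ L : Fin q → ((Fin q → ℂ) →ₗ[ℂ] ℂ),
      ∀ g : Fin q → H,
        (⨅ j : Fin q, LinearMap.ker ((L j).comp
          (((g j : LinearMap.GeneralLinearGroup ℂ (Fin q → ℂ)) :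
            (Fin q → ℂ) →ₗ[ℂ] (Fin q → ℂ))))) = ⊥ := by
  obtain ⟨L, hL⟩ := stmt_1_aux q H q le_rfl
  refine ⟨L, fun g => ?_⟩
  have := hL g
  exact Submodule.finrank_eq_zero.1 (by omega)
end

section
/- Let n ≥ 1 be an integer and λ = (λ₁, …, λₙ) ∈ ℂⁿ with λ_j ≠ 0 for every j. Regard ℤ_{≥0}ⁿ as a subset of ℚⁿ, and let M_λ = { k ∈ ℤ_{≥0}ⁿ : k₁λ₁ + ⋯ + kₙλₙ = 0 }. If the ℚ-linear span of M_λ in ℚⁿ has dimension n − 1, then there exists c ∈ ℂ, c ≠ 0, such that c·λ_j is a nonzero integer for every j = 1, …, n. In other words, up to multiplication by a nonvanishing complex number, (λ₁, …, λₙ) ∈ (ℤ \ {0})ⁿ. -/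
/-- If all `λ_j ≠ 0` and the resonance set
`M_λ = {k ∈ ℤ_{≥0}ⁿ : Σ k_j λ_j = 0}` (viewed inside `ℚⁿ`) spans a `ℚ`-subspace of
dimension `n - 1`, then some nonzero multiple `c·λ` has all entries nonzero integers. -/
theorem stmt_3 (n : ℕ) (hn : 1 ≤ n) (lam : Fin n → ℂ) (hlam : ∀ j, lam j ≠ 0)
    (M : Set (Fin n → ℚ))
    (hM : M = {k : Fin n → ℚ | (∀ i, ∃ m : ℕ, k i = m) ∧ ∑ i, (k i : ℂ) * lam i = 0})
    (hrank : Module.finrank ℚ (Submodule.span ℚ M) = n - 1) :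
    ∃ c : ℂ, c ≠ 0 ∧ ∀ j, ∃ m : ℤ, m ≠ 0 ∧ c * lam j = m := by
  let φ : (Fin n → ℚ) →ₗ[ℚ] ℂ := Fintype.linearCombination ℚ lam
  have hφ : ∀ k, φ k = ∑ i, (k i : ℂ) * lam i := by
    intro k
    simp [φ, Fintype.linearCombination_apply, Rat.smul_def]
  have hle : Submodule.span ℚ M ≤ LinearMap.ker φ := by
    rw [Submodule.span_le]
    intro k hk
    rw [hM] at hk
    simp only [SetLike.mem_coe, LinearMap.mem_ker, hφ]
    exact hk.2
  have h1 := Submodule.finrank_mono hle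
  have h2 := LinearMap.finrank_range_add_finrank_ker φ
  rw [Module.finrank_fin_fun] at h2
  have h3 : Module.finrank ℚ (LinearMap.range φ) ≤ 1 := by omega
  obtain ⟨v, hv⟩ := finrank_le_one_iff.mp h3
  have hq : ∀ j, ∃ q : ℚ, (q : ℂ) * (v : ℂ) = lam j := by
    intro j
    have hj : lam j ∈ LinearMap.range φ := ⟨Pi.single j 1, by simp [φ]⟩
    obtain ⟨q, hq⟩ := hv ⟨lam j, hj⟩
    refine ⟨q, ?_⟩
    have := congrArg Subtype.val hq
    simpa [Rat.smul_def] using this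
  choose q hq using hq
  have hv0 : (v : ℂ) ≠ 0 := by
    intro h
    apply hlam ⟨0, hn⟩
    rw [← hq, h, mul_zero]
  have hq0 : ∀ j, q j ≠ 0 := by
    intro j h
    apply hlam j
    rw [← hq, h]
    simp
  have hD : (∏ i, (q i).den) ≠ 0 := Finset.prod_ne_zero_iff.mpr fun i _ => (q i).den_nz
  refine ⟨((∏ i, (q i).den : ℕ) : ℂ) / v, div_ne_zero (Nat.cast_ne_zero.mpr hD) hv0, ?_⟩
  intro j
  obtain ⟨e, he⟩ := Finset.dvd_prod_of_mem (fun i => (q i).den) (Finset.mem_univ j)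
  have he0 : e ≠ 0 := by
    rintro rfl
    exact hD (by simpa using he)
  refine ⟨e * (q j).num, mul_ne_zero (by exact_mod_cast he0) (Rat.num_ne_zero.mpr (hq0 j)), ?_⟩
  have h4 : ((∏ i, (q i).den : ℕ) : ℂ) / v * lam j = (∏ i, (q i).den : ℕ) * (q j : ℂ) := by
    rw [← hq]
    field_simp
  rw [h4, he]
  have h5 : ((q j).den : ℂ) * (q j : ℂ) = (q j).num := by
    exact_mod_cast Rat.den_mul_eq_num (q j)
  push_cast
  rw [← h5]
  ring
end

section
/- On ℂ⁴ define f₁(x) = x₁² + x₂² + x₃² + x₄² and f₂(x) = x₁³ + x₂³ + x₃³ + x₄³. Then: (a) for every x ∈ ℂ⁴, the linear functionals Df₁(x) and Df₂(x) are linearly dependent over ℂ if and only if for all indices j, k one has x_j = 0 or x_k = 0 or x_j = x_k (equivalently: all nonzero coordinates of x are equal); and (b) if Df₁(x) and Df₂(x) are linearly dependent and moreover f₁(x) = 0 and f₂(x) = 0, then x = 0. -/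
lemma fderiv_powsum (n : ℕ) (f : (Fin 4 → ℂ) → ℂ) (hf : ∀ x : Fin 4 → ℂ, f x = ∑ k, x k ^ (n+1))
    (x v : Fin 4 → ℂ) : fderiv ℂ f x v = ∑ k, ((n : ℂ) + 1) * x k ^ n * v k := by
  have h : HasFDerivAt f (∑ k : Fin 4, (((n : ℂ) + 1) * x k ^ n) •
      (ContinuousLinearMap.proj k : (Fin 4 → ℂ) →L[ℂ] ℂ)) x := by
    rw [show f = fun x => ∑ k, x k ^ (n+1) from funext hf]
    refine HasFDerivAt.fun_sum fun k _ => ?_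
    have h1 : HasFDerivAt (fun y : Fin 4 → ℂ => y k)
      (ContinuousLinearMap.proj k : (Fin 4 → ℂ) →L[ℂ] ℂ) x := hasFDerivAt_apply k x
    have h2 := (hasDerivAt_pow (n+1) (x k)).comp_hasFDerivAt x h1
    simp only [Nat.cast_add, Nat.cast_one, Nat.add_sub_cancel] at h2
    exact h2
  rw [h.fderiv]
  simp

lemma dep_iff (f₁ f₂ : (Fin 4 → ℂ) → ℂ)
    (hf₁ : ∀ x : Fin 4 → ℂ, f₁ x = ∑ k, x k ^ 2)
    (hf₂ : ∀ x : Fin 4 → ℂ, f₂ x = ∑ k, x k ^ 3) (x : Fin 4 → ℂ) :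
    (¬ LinearIndependent ℂ ![fderiv ℂ f₁ x, fderiv ℂ f₂ x]) ↔
        ∀ j k : Fin 4, x j = 0 ∨ x k = 0 ∨ x j = x k := by
  have e1 := fderiv_powsum 1 f₁ hf₁ x
  have e2 := fderiv_powsum 2 f₂ hf₂ x
  rw [LinearIndependent.pair_iff]
  constructor
  · intro h j k
    by_contra! hc
    obtain ⟨hj, hk, hjk⟩ := hc
    apply h
    intro s t hst
    have key : ∀ i, x i ≠ 0 → 2 * s + 3 * t * x i = 0 := by
      intro i hi
      have := DFunLike.congr_fun hst (Pi.single i 1)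
      simp [e1, e2, Pi.single_apply] at this
      apply mul_left_cancel₀ hi
      linear_combination this
    have a := key j hj
    have b := key k hk
    have ht : t = 0 := by
      have : t * (x j - x k) = 0 := by linear_combination (a - b) / 3
      exact (mul_eq_zero.mp this).resolve_right (sub_ne_zero.mpr hjk)
    subst ht
    simpa using a
  · intro h hl
    by_cases hx : ∀ i, x i = 0
    · have := hl 1 0 (by ext v; simp [e1, hx])
      simp at this
    · push Not at hx
      obtain ⟨c, hc⟩ := hx
      have := hl (3 * x c) (-2) (by
        ext v
        simp only [ContinuousLinearMap.add_apply, ContinuousLinearMap.smul_apply, e1, e2,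
          smul_eq_mul, Finset.mul_sum, ← Finset.sum_add_distrib, ContinuousLinearMap.zero_apply]
        refine Finset.sum_eq_zero fun k _ => ?_
        rcases h c k with h | h | h
        · exact absurd h hc
        · simp [h]
        · rw [h]; push_cast; ring)
      simp at this

/-- For `f₁(x) = Σ x_k²` and `f₂(x) = Σ x_k³` on `ℂ⁴`: (a) `Df₁(x)` and
`Df₂(x)` are linearly dependent iff for all indices `j, k` one has `x_j = 0` or `x_k = 0` or
`x_j = x_k` (all nonzero coordinates equal); (b) if moreover `f₁(x) = 0` and `f₂(x) = 0`,
then `x = 0`. -/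
theorem stmt_17
    (f₁ f₂ : (Fin 4 → ℂ) → ℂ)
    (hf₁ : ∀ x : Fin 4 → ℂ, f₁ x = ∑ k, x k ^ 2)
    (hf₂ : ∀ x : Fin 4 → ℂ, f₂ x = ∑ k, x k ^ 3) :
    (∀ x : Fin 4 → ℂ,
      (¬ LinearIndependent ℂ ![fderiv ℂ f₁ x, fderiv ℂ f₂ x]) ↔
        ∀ j k : Fin 4, x j = 0 ∨ x k = 0 ∨ x j = x k) ∧
    (∀ x : Fin 4 → ℂ,
      ¬ LinearIndependent ℂ ![fderiv ℂ f₁ x, fderiv ℂ f₂ x] →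
      f₁ x = 0 → f₂ x = 0 → x = 0) := by
  refine ⟨dep_iff f₁ f₂ hf₁ hf₂, fun x hd h1 _ => ?_⟩
  have h := (dep_iff f₁ f₂ hf₁ hf₂ x).1 hd
  by_contra hx
  obtain ⟨c, hc⟩ := Function.ne_iff.mp hx
  simp only [Pi.zero_apply] at hc
  have hk : ∀ k, x k ^ 2 = x c ^ 2 * (if x k = 0 then (0 : ℕ) else 1 : ℕ) := by
    intro k
    rcases h c k with h | h | h
    · exact absurd h hc
    · simp [h]
    · simp [← h, hc]
  rw [hf₁, Finset.sum_congr rfl fun k _ => hk k, ← Finset.mul_sum, ← Nat.cast_sum] at h1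
  have h2 := (mul_eq_zero.mp h1).resolve_left (pow_ne_zero 2 hc)
  rw [Nat.cast_eq_zero, Finset.sum_eq_zero_iff] at h2
  simpa [hc] using h2 c (Finset.mem_univ c)
end
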